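/- arXiv:2202.05059 — 2 statements merged into one kernel-verified Lean document; each statement's English description precedes it below -/
import Mathlib

section
/- Let M ≥ 2 and P ≥ 1 be integers, c ∈ ℝ^P, and let f(x) := Σ_{p=0}^{P−1} c_p · β_{M,P}(x − 2πp/P). Then the Fourier coefficients of f satisfy: f̂[0] = (1/P)·Σ_{p=0}^{P−1} c_p, and for every k ∈ ℤ with k ≠ 0, (ik)^M · f̂[k] = (P^{M−1}/(2π)^M) · Σ_{p=0}^{P−1} (d ⊛ c)[p] · e^{−2πikp/P}, where d = d_{M,P} and ⊛ denotes cyclic convolution. Equivalently, the innovation measure of the uniform spline f (the unique zero-mean measure w with f = f̂[0] + g_M ⊛ w) is w = (P^{M−1}/(2π)^M) · Σ_{p=0}^{P−1} (d ⊛ c)[p] · δ_{2πp/P}. -/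
open MeasureTheory Filter
open scoped ENNReal Real

noncomputable section

instance fact2pi : Fact (0 < 2 * Real.pi) := ⟨by positivity⟩

/-- The circle `𝕋 = ℝ/(2πℤ)`. -/
abbrev Circle2pi : Type := AddCircle (2 * Real.pi)

/-- Integral of a real function against a finite real signed (Radon) measure on `𝕋`. -/
noncomputable def sIntR (w : SignedMeasure Circle2pi) (f : Circle2pi → ℝ) : ℝ :=
  (∫ x, f x ∂w.toJordanDecomposition.posPart) - ∫ x, f x ∂w.toJordanDecomposition.negPart

/-- Integral of a complex function against a signed measure on `𝕋`. -/
noncomputable def sIntC (w : SignedMeasure Circle2pi) (f : Circle2pi → ℂ) : ℂ :=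
  (∫ x, f x ∂w.toJordanDecomposition.posPart) - ∫ x, f x ∂w.toJordanDecomposition.negPart

/-- Total-variation norm `‖w‖_M` of a signed measure on `𝕋`. -/
noncomputable def tvNorm (w : SignedMeasure Circle2pi) : ℝ :=
  (w.totalVariation Set.univ).toReal

/-- The `k`-th Fourier coefficient `ŵ[k] = ∫_𝕋 e^{-ikx} dw(x)` of a signed measure. -/
noncomputable def fCoeff (w : SignedMeasure Circle2pi) (k : ℤ) : ℂ :=
  sIntC w fun x => fourier (-k) x

/-- The Dirac measure `δ_x` as a signed measure. -/
noncomputable def diracSM (x : Circle2pi) : SignedMeasure Circle2pi :=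
  (MeasureTheory.Measure.dirac x).toSignedMeasure

/-- The periodic Green's function `g_M(x) = Σ_{k≠0} e^{ikx}/(ik)^M` of `D^M` (complex form). -/
noncomputable def greenC (M : ℕ) (x : Circle2pi) : ℂ :=
  ∑' k : ℤ, if k = 0 then 0 else fourier k x / (Complex.I * (k : ℂ)) ^ M

/-- The (real-valued) periodic Green's function of `D^M`. -/
noncomputable def greenR (M : ℕ) (x : Circle2pi) : ℝ := (greenC M x).re

/-- The convolution `(g_M ⊛ w)(x) = ∫_𝕋 g_M(x-t) dw(t)`. -/
noncomputable def greenConv (M : ℕ) (w : SignedMeasure Circle2pi) (x : Circle2pi) : ℝ :=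
  sIntR w fun t => greenR M (x - t)

/-- The grid point `2πp/P ∈ 𝕋`. -/
noncomputable def gridPt (P : ℕ) (p : Fin P) : Circle2pi :=
  ((2 * Real.pi * (p.1 : ℝ) / (P : ℝ) : ℝ) : Circle2pi)

/-- The grid-restricted class: `w = Σ_{p=0}^{P-1} c_p δ_{2πp/P}` with `Σ_p c_p = 0`. -/
def IsGridMeasure (P : ℕ) (w : SignedMeasure Circle2pi) : Prop :=
  ∃ c : Fin P → ℝ, (∑ p, c p) = 0 ∧ w = ∑ p, c p • diracSM (gridPt P p)

/-- Fourier coefficients of the periodic B-spline: `β̂[0] = 1/P` and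
`β̂[k] = P^{M-1}((1-e^{-2πik/P})/(2πik))^M` for `k ≠ 0`. -/
noncomputable def bsplineCoeff (M P : ℕ) (k : ℤ) : ℂ :=
  if k = 0 then 1 / (P : ℂ)
  else (P : ℂ) ^ (M - 1) *
    ((1 - Complex.exp (-(2 * Real.pi * Complex.I * (k : ℂ)) / (P : ℂ))) /
      (2 * Real.pi * Complex.I * (k : ℂ))) ^ M

/-- The periodic B-spline `β_{M,P}(x) = Σ_k β̂[k] e^{ikx}` (real-valued). -/
noncomputable def bspline (M P : ℕ) (x : Circle2pi) : ℝ :=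
  (∑' k : ℤ, bsplineCoeff M P k * fourier k x).re

/-- The `P`-periodized finite-difference filter
`d_{M,P}[p] = Σ_{0 ≤ m ≤ M, m ≡ p (mod P)} (-1)^m C(M,m)`. -/
def dFilter (M P : ℕ) (p : Fin P) : ℝ :=
  ∑ m ∈ Finset.range (M + 1), if m % P = p.1 then (-1 : ℝ) ^ m * (M.choose m) else 0

/-- Cyclic convolution `(d ⊛ c)[p] = Σ_q d[(p-q) mod P]·c[q]`. -/
def cconv (P : ℕ) (d c : Fin P → ℝ) (p : Fin P) : ℝ := ∑ q, d (p - q) * c q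

/-- The `k`-th Fourier coefficient `(1/2π)∫₀^{2π} h(x) e^{-ikx} dx` of a `2π`-periodic function. -/
noncomputable def periodicFourierCoeff (h : ℝ → ℂ) (k : ℤ) : ℂ :=
  (1 / (2 * Real.pi) : ℂ) *
    ∫ x in (0 : ℝ)..(2 * Real.pi), h x * Complex.exp (-(Complex.I * (k : ℂ) * (x : ℂ)))

end


lemma zpowP (P : ℕ) (hP : 1 ≤ P) (k : ℤ) :
    Complex.exp (-(2 * Real.pi * Complex.I * (k : ℂ)) / (P : ℂ)) ^ P = 1 := by
  rw [← Complex.exp_nat_mul, Complex.exp_eq_one_iff]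
  refine ⟨-k, ?_⟩
  have : (P : ℂ) ≠ 0 := by exact_mod_cast (by omega : P ≠ 0)
  field_simp
  push_cast
  ring

lemma zpow_p (P : ℕ) (k : ℤ) (p : Fin P) :
    Complex.exp (-(2 * Real.pi * Complex.I * (k : ℂ) * (p.1 : ℂ)) / (P : ℂ)) =
      Complex.exp (-(2 * Real.pi * Complex.I * (k : ℂ)) / (P : ℂ)) ^ p.1 := by
  rw [← Complex.exp_nat_mul]
  congr 1
  ring

lemma fourier_grid (P : ℕ) (k : ℤ) (p : Fin P) :
    fourier (-k) (gridPt P p) =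
      Complex.exp (-(2 * Real.pi * Complex.I * (k : ℂ)) / (P : ℂ)) ^ p.1 := by
  rw [← zpow_p, gridPt, fourier_coe_apply]
  congr 1
  have : (Real.pi : ℂ) ≠ 0 := by exact_mod_cast Real.pi_ne_zero
  push_cast
  field_simp

lemma fourier_sub_grid (P : ℕ) (k : ℤ) (p : Fin P) (x : Circle2pi) :
    fourier k (x - gridPt P p) = fourier k x *
      Complex.exp (-(2 * Real.pi * Complex.I * (k : ℂ)) / (P : ℂ)) ^ p.1 := by
  rw [← fourier_grid]
  have h : k • (x - gridPt P p) = k • x + (-k) • gridPt P p := by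
    rw [smul_sub, neg_smul, sub_eq_add_neg]
  rw [fourier_apply, fourier_apply, fourier_apply, h, AddCircle.toCircle_add, Circle.coe_mul]

lemma dfilter_dft (M P : ℕ) (hP : 1 ≤ P) (z : ℂ) (hz : z ^ P = 1) :
    ∑ p : Fin P, (dFilter M P p : ℂ) * z ^ p.1 = (1 - z) ^ M := by
  have h1 : ∀ m : ℕ, z ^ m = z ^ (m % P) := fun m => by
    conv_lhs => rw [← Nat.mod_add_div m P, pow_add, pow_mul, hz, one_pow, mul_one]
  have h2 : (1 - z) ^ M = ∑ m ∈ Finset.range (M + 1), (-1 : ℂ) ^ m * (M.choose m) * z ^ m := by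
    rw [show (1 - z) = -z + 1 by ring, add_pow]
    refine Finset.sum_congr rfl fun m _ => ?_
    rw [neg_pow]; ring
  rw [h2]
  simp only [dFilter, Complex.ofReal_sum, Finset.sum_mul]
  rw [Finset.sum_comm]
  refine Finset.sum_congr rfl fun m _ => ?_
  rw [Finset.sum_eq_single (⟨m % P, Nat.mod_lt _ (by omega)⟩ : Fin P)]
  · simp [← h1]
  · intro b _ hb
    rw [if_neg]
    · simp
    · intro h; exact hb (Fin.ext h.symm)
  · simp

lemma cconv_dft (P : ℕ) (hP : 1 ≤ P) (d c : Fin P → ℝ) (z : ℂ) (hz : z ^ P = 1) :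
    ∑ p : Fin P, (cconv P d c p : ℂ) * z ^ p.1 =
      (∑ p : Fin P, (d p : ℂ) * z ^ p.1) * ∑ p : Fin P, (c p : ℂ) * z ^ p.1 := by
  have : NeZero P := ⟨by omega⟩
  have h1 : ∀ m : ℕ, z ^ m = z ^ (m % P) := fun m => by
    conv_lhs => rw [← Nat.mod_add_div m P, pow_add, pow_mul, hz, one_pow, mul_one]
  simp only [cconv, Complex.ofReal_sum, Finset.sum_mul]
  rw [Finset.sum_comm, ← Finset.sum_mul, Finset.mul_sum]
  refine Finset.sum_congr rfl fun q _ => ?_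
  rw [Finset.sum_mul, ← Equiv.sum_comp (Equiv.addRight q)]
  refine Finset.sum_congr rfl fun p _ => ?_
  simp only [Equiv.coe_addRight, add_sub_cancel_right, Fin.val_add, ← h1, pow_add]
  push_cast
  ring

lemma summable_green (M : ℕ) (hM : 2 ≤ M) :
    Summable fun k : ℤ => ‖if k = 0 then 0 else 1 / (Complex.I * (k : ℂ)) ^ M‖ := by
  have := ((Real.summable_one_div_int_pow (p := M)).2 (by omega)).abs
  refine this.of_nonneg_of_le (fun _ => norm_nonneg _) fun k => ?_
  split_ifs with h
  · simp
  · simp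

lemma coeff_eq (M P : ℕ) (k : ℤ) (hk : k ≠ 0) :
    bsplineCoeff M P k = (P : ℂ) ^ (M - 1) / (((2 * Real.pi : ℝ) : ℂ)) ^ M *
      (1 - Complex.exp (-(2 * Real.pi * Complex.I * (k : ℂ)) / (P : ℂ))) ^ M *
      (1 / (Complex.I * (k : ℂ)) ^ M) := by
  rw [bsplineCoeff, if_neg hk]
  rw [div_pow, show (2 * Real.pi * Complex.I * (k : ℂ)) = 
    ((2 * Real.pi : ℝ) : ℂ) * (Complex.I * k) by push_cast; ring, mul_pow]
  ring

lemma norm_z (P : ℕ) (hP : 1 ≤ P) (k : ℤ) :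
    ‖Complex.exp (-(2 * Real.pi * Complex.I * (k : ℂ)) / (P : ℂ))‖ = 1 := by
  rw [← pow_eq_one_iff_of_nonneg (norm_nonneg _) (n := P) (by omega), ← norm_pow, zpowP P hP k, norm_one]

lemma summable_coeff (M P : ℕ) (hM : 2 ≤ M) (hP : 1 ≤ P) :
    Summable fun k : ℤ => ‖bsplineCoeff M P k‖ := by
  rw [← (Set.finite_singleton (0 : ℤ)).summable_compl_iff]
  have := ((summable_green M hM).mul_left (‖(P : ℂ) ^ (M - 1) / (((2 * Real.pi : ℝ) : ℂ)) ^ M‖ * 2 ^ M)).subtype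
    ({0}ᶜ : Set ℤ)
  refine this.of_nonneg_of_le (fun _ => norm_nonneg _) fun k => ?_
  have hk : (k : ℤ) ≠ 0 := k.2
  simp only [Function.comp]
  rw [coeff_eq M P k hk, norm_mul, norm_mul, if_neg hk]
  gcongr
  rw [norm_pow]
  gcongr
  refine (norm_sub_le _ _).trans ?_
  rw [norm_z P hP]; norm_num

lemma conj_coeff (M P : ℕ) (k : ℤ) :
    (starRingEnd ℂ) (bsplineCoeff M P k) = bsplineCoeff M P (-k) := by
  unfold bsplineCoeff
  by_cases hk : k = 0
  · simp [hk]
  · rw [if_neg hk, if_neg (by simpa using hk)]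
    have h2 : (starRingEnd ℂ) 2 = 2 := map_ofNat _ 2
    simp [← Complex.exp_conj, h2]

lemma bspline_ofReal (M P : ℕ) (x : Circle2pi) :
    (bspline M P x : ℂ) = ∑' k : ℤ, bsplineCoeff M P k * fourier k x := by
  rw [bspline, ← Complex.conj_eq_iff_re, Complex.conj_tsum,
    ← (Equiv.neg ℤ).tsum_eq (fun k : ℤ => bsplineCoeff M P k * fourier k x)]
  refine tsum_congr fun k => ?_
  rw [map_mul, conj_coeff, ← fourier_neg]
  rfl

lemma norm_fourier_pt (k : ℤ) (x : Circle2pi) : ‖fourier k x‖ = 1 := by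
  rw [fourier_apply]; exact Circle.norm_coe _

lemma f_hasSum (M P : ℕ) (hM : 2 ≤ M) (hP : 1 ≤ P) (c : Fin P → ℝ) (x : Circle2pi) :
    HasSum (fun k : ℤ => (bsplineCoeff M P k * ∑ p : Fin P, (c p : ℂ) *
      Complex.exp (-(2 * Real.pi * Complex.I * (k : ℂ)) / (P : ℂ)) ^ p.1) * fourier k x)
      ((∑ p, c p * bspline M P (x - gridPt P p) : ℝ) : ℂ) := by
  push_cast
  have h : ∀ p ∈ (Finset.univ : Finset (Fin P)), HasSum (fun k : ℤ => (c p : ℂ) * (bsplineCoeff M P k * fourier k (x - gridPt P p)))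
      ((c p : ℂ) * (bspline M P (x - gridPt P p) : ℂ)) := fun p _ => by
    rw [bspline_ofReal]
    refine (Summable.hasSum ?_).mul_left _
    refine Summable.of_norm ?_
    simpa only [norm_mul, norm_fourier_pt, mul_one] using summable_coeff M P hM hP
  convert hasSum_sum h using 2 with k
  rw [Finset.mul_sum, Finset.sum_mul]
  refine Finset.sum_congr rfl fun p _ => ?_
  rw [fourier_sub_grid]; ring

lemma summable_F (M P : ℕ) (hM : 2 ≤ M) (hP : 1 ≤ P) (c : Fin P → ℝ) :
    Summable fun k : ℤ => ‖bsplineCoeff M P k * ∑ p : Fin P, (c p : ℂ) *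
      Complex.exp (-(2 * Real.pi * Complex.I * (k : ℂ)) / (P : ℂ)) ^ p.1‖ := by
  refine ((summable_coeff M P hM hP).mul_right (∑ p, ‖(c p : ℂ)‖)).of_nonneg_of_le
    (fun _ => norm_nonneg _) fun k => ?_
  rw [norm_mul]
  gcongr
  refine (norm_sum_le _ _).trans (Finset.sum_le_sum fun p _ => ?_)
  rw [norm_mul, norm_pow, norm_z P hP, one_pow, mul_one]

lemma fourierCoeff_series (F : ℤ → ℂ) (hF : Summable fun k => ‖F k‖) (h : Circle2pi → ℂ)
    (hh : ∀ x, HasSum (fun k => F k * fourier k x) (h x)) (n : ℤ) :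
    fourierCoeff h n = F n := by
  have h1 : HasSum (fun k => ∫ x : Circle2pi, fourier (-n) x • (F k * fourier k x) ∂AddCircle.haarAddCircle)
      (∫ x : Circle2pi, ∑' k, fourier (-n) x • (F k * fourier k x) ∂AddCircle.haarAddCircle) := by
    refine hasSum_integral_of_summable_integral_norm (fun k => ?_) ?_
    · exact (Continuous.integrable_of_hasCompactSupport (by fun_prop) (HasCompactSupport.of_compactSpace _))
    · simpa only [norm_smul, norm_mul, norm_fourier_pt, mul_one, one_mul, integral_const, probReal_univ, one_smul] using hF
  have h2 : (∫ x : Circle2pi, ∑' k, fourier (-n) x • (F k * fourier k x) ∂AddCircle.haarAddCircle)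
      = fourierCoeff h n := by
    rw [fourierCoeff]
    congr 1; ext x
    exact ((hh x).const_smul _).tsum_eq
  rw [h2] at h1
  refine h1.unique ?_
  have h3 : ∀ k, ∫ x : Circle2pi, fourier (-n) x • (F k * fourier k x) ∂AddCircle.haarAddCircle
      = if k = n then F n else 0 := fun k => by
    have := fourierCoeff.const_mul (fun x : Circle2pi => fourier k x) (F k) n
    rw [fourierCoeff] at this
    rw [this, fourierCoeff_fourier]
    by_cases hk : k = n
    · subst hk; simp
    · simp [hk, Pi.single_apply, Ne.symm hk]
  simp only [h3]
  exact hasSum_ite_eq n (F n)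

lemma pfc_eq (h : Circle2pi → ℂ) (k : ℤ) :
    periodicFourierCoeff (fun x : ℝ => h (x : Circle2pi)) k = fourierCoeff h k := by
  rw [fourierCoeff_eq_intervalIntegral h k 0, periodicFourierCoeff, zero_add, Complex.real_smul]
  congr 1
  · push_cast; rfl
  · refine intervalIntegral.integral_congr fun x _ => ?_
    simp only [smul_eq_mul]
    rw [mul_comm, fourier_coe_apply]
    congr 2
    have : (Real.pi : ℂ) ≠ 0 := by exact_mod_cast Real.pi_ne_zero
    push_cast
    field_simp

lemma sIntR_sub (μ ν : Measure Circle2pi) [IsFiniteMeasure μ] [IsFiniteMeasure ν]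
    (g : Circle2pi → ℝ) (hg : Continuous g) :
    sIntR (μ.toSignedMeasure - ν.toSignedMeasure) g = (∫ x, g x ∂μ) - ∫ x, g x ∂ν := by
  have hi : ∀ (ρ : Measure Circle2pi) [IsFiniteMeasure ρ], Integrable g ρ := fun ρ _ =>
    hg.integrable_of_hasCompactSupport (HasCompactSupport.of_compactSpace _)
  set w := μ.toSignedMeasure - ν.toSignedMeasure with hw
  have h := SignedMeasure.toSignedMeasure_toJordanDecomposition w
  rw [JordanDecomposition.toSignedMeasure] at h
  have h2 : w.toJordanDecomposition.posPart + ν = μ + w.toJordanDecomposition.negPart := by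
    rw [← Measure.toSignedMeasure_eq_toSignedMeasure_iff, Measure.toSignedMeasure_add,
      Measure.toSignedMeasure_add]
    rw [hw] at h
    exact sub_eq_sub_iff_add_eq_add.mp h
  have h3 := congrArg (fun ρ : Measure Circle2pi => ∫ x, g x ∂ρ) h2
  beta_reduce at h3
  rw [integral_add_measure (hi _) (hi _), integral_add_measure (hi _) (hi _)] at h3
  rw [sIntR]
  linarith

lemma sIntR_rep (w : SignedMeasure Circle2pi) (g : Circle2pi → ℝ) : 
    w = w.toJordanDecomposition.posPart.toSignedMeasure - w.toJordanDecomposition.negPart.toSignedMeasure :=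
  (SignedMeasure.toSignedMeasure_toJordanDecomposition w).symm

lemma sIntR_add (w v : SignedMeasure Circle2pi) (g : Circle2pi → ℝ) (hg : Continuous g) :
    sIntR (w + v) g = sIntR w g + sIntR v g := by
  have hi : ∀ (ρ : Measure Circle2pi) [IsFiniteMeasure ρ], Integrable g ρ := fun ρ _ =>
    hg.integrable_of_hasCompactSupport (HasCompactSupport.of_compactSpace _)
  have : w + v = (w.toJordanDecomposition.posPart + v.toJordanDecomposition.posPart).toSignedMeasure
      - (w.toJordanDecomposition.negPart + v.toJordanDecomposition.negPart).toSignedMeasure := by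
    conv_lhs => rw [sIntR_rep w g, sIntR_rep v g]
    rw [Measure.toSignedMeasure_add, Measure.toSignedMeasure_add]
    abel
  rw [this, sIntR_sub _ _ g hg, integral_add_measure (hi _) (hi _), integral_add_measure (hi _) (hi _),
    sIntR, sIntR]
  ring

lemma sIntR_smul_dirac (r : ℝ) (x : Circle2pi) (g : Circle2pi → ℝ) (hg : Continuous g) :
    sIntR (r • diracSM x) g = r * g x := by
  have : r • diracSM x = (r.toNNReal • Measure.dirac x).toSignedMeasure
      - ((-r).toNNReal • Measure.dirac x).toSignedMeasure := by
    rw [Measure.toSignedMeasure_smul, Measure.toSignedMeasure_smul, diracSM, NNReal.smul_def,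
      NNReal.smul_def]
    refine Eq.trans ?_ (sub_smul _ _ _)
    congr 1
    rw [Real.coe_toNNReal', Real.coe_toNNReal', max_zero_sub_max_neg_zero_eq_self]
  rw [this, sIntR_sub _ _ g hg, integral_smul_nnreal_measure, integral_smul_nnreal_measure,
    integral_dirac, NNReal.smul_def, NNReal.smul_def, ← sub_smul,
    Real.coe_toNNReal', Real.coe_toNNReal', max_zero_sub_max_neg_zero_eq_self, smul_eq_mul]

lemma sIntR_sum {ι : Type*} (s : Finset ι) (r : ι → ℝ) (x : ι → Circle2pi) (g : Circle2pi → ℝ)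
    (hg : Continuous g) :
    sIntR (∑ p ∈ s, r p • diracSM (x p)) g = ∑ p ∈ s, r p * g (x p) := by
  classical
  induction s using Finset.induction_on with
  | empty =>
    have := sIntR_smul_dirac 0 0 g hg
    simpa using this
  | insert a s ha ih =>
    rw [Finset.sum_insert ha, Finset.sum_insert ha, sIntR_add _ _ g hg, ih, sIntR_smul_dirac _ _ g hg]

lemma green_summable_pt (M : ℕ) (hM : 2 ≤ M) (x : Circle2pi) :
    Summable fun k : ℤ => if k = 0 then (0 : ℂ) else fourier k x / (Complex.I * (k : ℂ)) ^ M := by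
  refine Summable.of_norm ((summable_green M hM).congr fun k => ?_)
  split_ifs
  · rfl
  · rw [norm_div, norm_div, norm_fourier_pt, norm_one]

lemma continuous_greenR (M : ℕ) (hM : 2 ≤ M) : Continuous (greenR M) := by
  refine Complex.continuous_re.comp ?_
  unfold greenC
  refine continuous_tsum (fun k => ?_) (summable_green M hM) fun k x => ?_
  · split_ifs
    · exact continuous_const
    · exact (map_continuous (fourier k)).div_const _
  · split_ifs
    · rfl
    · rw [norm_div, norm_div, norm_fourier_pt, norm_one]

lemma HasSum.congr_aux {F G : ℤ → ℂ} {a : ℂ} (h : HasSum F a) (hFG : ∀ k, G k = F k) :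
    HasSum G a := by
  rwa [funext hFG]

lemma HasSum.hasSum_ite_zero_aux {F : ℤ → ℂ} {a b : ℂ} (h : HasSum F a)
    (h' : HasSum (fun k => if k = 0 then 0 else F k) b) : a = F 0 + b := by
  have h1 : HasSum (fun k : ℤ => if k = 0 then F 0 else 0) (F 0) := hasSum_ite_eq 0 (F 0)
  have h2 := HasSum.add h1 h'
  refine HasSum.unique h (HasSum.congr_aux h2 fun k => ?_)
  by_cases hk : k = 0 <;> simp [hk]

/-- For `f = Σ_p c_p β_{M,P}(· - 2πp/P)`: `f̂[0] = (1/P)Σ_p c_p`, and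
`(ik)^M f̂[k] = (P^{M-1}/(2π)^M) Σ_p (d ⊛ c)[p] e^{-2πikp/P}` for `k ≠ 0`; equivalently
the innovation measure of `f` is `w = (P^{M-1}/(2π)^M) Σ_p (d ⊛ c)[p] δ_{2πp/P}`, a
zero-mean measure with `f = f̂[0] + g_M ⊛ w`. -/
theorem stmt12 (M P : ℕ) (hM : 2 ≤ M) (hP : 1 ≤ P) (c : Fin P → ℝ)
    (f : Circle2pi → ℝ)
    (hf : ∀ x, f x = ∑ p, c p * bspline M P (x - gridPt P p))
    (w : SignedMeasure Circle2pi)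
    (hw : w = ∑ p,
      ((P : ℝ) ^ (M - 1) / (2 * Real.pi) ^ M * cconv P (dFilter M P) c p) •
        diracSM (gridPt P p)) :
    periodicFourierCoeff (fun x : ℝ => ((f ((x : ℝ) : Circle2pi) : ℝ) : ℂ)) 0 =
      (((1 / (P : ℝ)) * ∑ p, c p : ℝ) : ℂ) ∧
    (∀ k : ℤ, k ≠ 0 →
      (Complex.I * (k : ℂ)) ^ M *
          periodicFourierCoeff (fun x : ℝ => ((f ((x : ℝ) : Circle2pi) : ℝ) : ℂ)) k =
        ((P : ℂ) ^ (M - 1) / (((2 * Real.pi : ℝ) : ℂ)) ^ M) *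
          ∑ p, ((cconv P (dFilter M P) c p : ℝ) : ℂ) *
            Complex.exp (-(2 * Real.pi * Complex.I * (k : ℂ) * (p.1 : ℂ)) / (P : ℂ))) ∧
    w Set.univ = 0 ∧
    ∀ x : Circle2pi, f x = (1 / (P : ℝ)) * (∑ p, c p) + greenConv M w x := by
  have : NeZero P := ⟨by omega⟩
  have hP0 : (P : ℂ) ≠ 0 := by exact_mod_cast (by omega : P ≠ 0)
  have hsum : ∀ x, HasSum (fun k : ℤ => (bsplineCoeff M P k * ∑ p : Fin P, (c p : ℂ) *
      Complex.exp (-(2 * Real.pi * Complex.I * (k : ℂ)) / (P : ℂ)) ^ p.1) * fourier k x)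
      ((f x : ℝ) : ℂ) := fun x => by
    rw [hf x]; exact f_hasSum M P hM hP c x
  have hcoef : ∀ k, periodicFourierCoeff (fun x : ℝ => ((f ((x : ℝ) : Circle2pi) : ℝ) : ℂ)) k =
      bsplineCoeff M P k * ∑ p : Fin P, (c p : ℂ) *
      Complex.exp (-(2 * Real.pi * Complex.I * (k : ℂ)) / (P : ℂ)) ^ p.1 := fun k => by
    rw [pfc_eq (fun x => ((f x : ℝ) : ℂ)) k]
    exact fourierCoeff_series _ (summable_F M P hM hP c) _ hsum k
  have hconv : ∀ k : ℤ, ∑ p : Fin P, (cconv P (dFilter M P) c p : ℂ) *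
      Complex.exp (-(2 * Real.pi * Complex.I * (k : ℂ)) / (P : ℂ)) ^ p.1 =
      (1 - Complex.exp (-(2 * Real.pi * Complex.I * (k : ℂ)) / (P : ℂ))) ^ M *
      ∑ p : Fin P, (c p : ℂ) *
      Complex.exp (-(2 * Real.pi * Complex.I * (k : ℂ)) / (P : ℂ)) ^ p.1 := fun k => by
    rw [cconv_dft P hP _ _ _ (zpowP P hP k), dfilter_dft M P hP _ (zpowP P hP k)]
  refine ⟨?_, ?_, ?_, ?_⟩
  · rw [hcoef 0]
    simp [bsplineCoeff]
  · intro k hk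
    have hk' : (Complex.I * (k : ℂ)) ^ M ≠ 0 :=
      pow_ne_zero _ (mul_ne_zero Complex.I_ne_zero (by exact_mod_cast hk))
    simp only [zpow_p]
    rw [hcoef k, hconv k, coeff_eq M P k hk]
    field_simp
  · have h0 := hconv 0
    have h1 : ∑ p : Fin P, cconv P (dFilter M P) c p = 0 := by
      have hM0 : M ≠ 0 := by omega
      simp [hM0] at h0
      exact_mod_cast h0
    have h2 : ∀ x, (diracSM x) Set.univ = 1 := fun x => by
      rw [diracSM, Measure.toSignedMeasure_apply_measurable MeasurableSet.univ]; simp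
    have h3 : ∀ (s : Finset (Fin P)) (r : Fin P → ℝ),
        (∑ p ∈ s, r p • diracSM (gridPt P p)) Set.univ = ∑ p ∈ s, r p := fun s r => by
      induction s using Finset.induction_on with
      | empty => simp
      | insert a s ha ih =>
        rw [Finset.sum_insert ha, Finset.sum_insert ha, _root_.add_apply, ih, _root_.smul_apply, h2,
          smul_eq_mul, mul_one]
    rw [hw, h3, ← Finset.mul_sum, h1, mul_zero]
  · intro x
    have hc : Continuous fun t => greenR M (x - t) :=
      (continuous_greenR M hM).comp (continuous_const.sub continuous_id)
    rw [hw, greenConv, sIntR_sum _ _ _ _ hc]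
    have h1 : HasSum (fun k : ℤ => if k = 0 then (0 : ℂ) else
        (bsplineCoeff M P k * ∑ p : Fin P, (c p : ℂ) *
        Complex.exp (-(2 * Real.pi * Complex.I * (k : ℂ)) / (P : ℂ)) ^ p.1) * fourier k x)
        (∑ p, (((P : ℝ) ^ (M - 1) / (2 * Real.pi) ^ M * cconv P (dFilter M P) c p : ℝ) : ℂ) *
          greenC M (x - gridPt P p)) := by
      have h : ∀ p ∈ (Finset.univ : Finset (Fin P)), HasSum (fun k : ℤ =>
          (((P : ℝ) ^ (M - 1) / (2 * Real.pi) ^ M * cconv P (dFilter M P) c p : ℝ) : ℂ) *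
          (if k = 0 then (0 : ℂ) else fourier k (x - gridPt P p) / (Complex.I * (k : ℂ)) ^ M))
          ((((P : ℝ) ^ (M - 1) / (2 * Real.pi) ^ M * cconv P (dFilter M P) c p : ℝ) : ℂ) *
          greenC M (x - gridPt P p)) := fun p _ =>
        (green_summable_pt M hM _).hasSum.mul_left _
      refine HasSum.congr_aux (hasSum_sum h) ?_
      intro k
      by_cases hk : k = 0
      · simp [hk]
      · simp only [if_neg hk]
        rw [coeff_eq M P k hk]
        have := hconv k
        calc _ = (P : ℂ) ^ (M - 1) / (((2 * Real.pi : ℝ) : ℂ)) ^ M * (1 / (Complex.I * (k : ℂ)) ^ M)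
              * fourier k x * ((1 - Complex.exp (-(2 * Real.pi * Complex.I * (k : ℂ)) / (P : ℂ))) ^ M *
      ∑ p : Fin P, (c p : ℂ) *
      Complex.exp (-(2 * Real.pi * Complex.I * (k : ℂ)) / (P : ℂ)) ^ p.1) := by ring
          _ = _ := by
            rw [← this, Finset.mul_sum]
            refine Finset.sum_congr rfl fun p _ => ?_
            rw [fourier_sub_grid]
            push_cast
            ring
    have h2 := (hsum x).hasSum_ite_zero_aux h1
    have h3 := congrArg Complex.re h2
    simp only [Complex.add_re, Complex.re_sum, Complex.re_ofReal_mul, Complex.ofReal_re] at h3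
    have h4 : ((bsplineCoeff M P 0 * ∑ p : Fin P, (c p : ℂ) *
        Complex.exp (-(2 * Real.pi * Complex.I * ((0 : ℤ) : ℂ)) / (P : ℂ)) ^ p.1) *
        fourier 0 x) = (((1 / (P : ℝ)) * ∑ p, c p : ℝ) : ℂ) := by
      rw [fourier_zero]
      simp [bsplineCoeff]
    rw [h4, Complex.ofReal_re] at h3
    exact h3
end

section
/- Let M ≥ 2, P ≥ 1, Kc ≥ 0 be integers, λ > 0, and y = (y₀, …, y_{Kc}) ∈ ℝ × ℂ^{Kc}. Define the matrix H ∈ ℂ^{(Kc+1)×P} by H_{k,p} := e^{−2πikp/P}·β̂[k] for 0 ≤ k ≤ Kc and 0 ≤ p ≤ P−1, and the discrete objective G(c) := ½·Σ_{k=0}^{Kc} |y_k − (Hc)_k|² + λ·(P^{M−1}/(2π)^M)·Σ_{p=0}^{P−1} |(d ⊛ c)[p]| for c ∈ ℝ^P. For c ∈ ℝ^P set w_c := (P^{M−1}/(2π)^M)·Σ_{p=0}^{P−1} (d ⊛ c)[p]·δ_{2πp/P} and a_c := (1/P)·Σ_{p=0}^{P−1} c_p. Then: (i) the map c ↦ (w_c,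 a_c) is a bijection from ℝ^P onto the grid-restricted class {(w,a) : w = Σ_{p=0}^{P−1} b_p δ_{2πp/P}, Σ_p b_p = 0, a ∈ ℝ}; (ii) for every c ∈ ℝ^P, J(w_c, a_c) = G(c), where J(w,a) := ½(|y₀ − a|² + Σ_{k=1}^{Kc} |y_k − ŵ[k]/(ik)^M|²) + λ‖w‖_M. Consequently, c* minimizes G over ℝ^P if and only if (w_{c*}, a_{c*}) minimizes J over the grid-restricted class. -/
open MeasureTheory Filter
open scoped ENNReal Real

noncomputable section

/-- The quadratic objective
`J(w,a) = ½(|y₀-a|² + Σ_{k=1}^{Kc} |y_k - ŵ[k]/(ik)^M|²) + λ‖w‖_M`. -/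
noncomputable def quadJ (M Kc : ℕ) (y0 : ℝ) (yr : Fin Kc → ℂ) (lam : ℝ)
    (w : SignedMeasure Circle2pi) (a : ℝ) : ℝ :=
  (1 / 2) * ((y0 - a) ^ 2 +
      ∑ k : Fin Kc,
        ‖yr k - fCoeff w ((k.1 : ℤ) + 1) / (Complex.I * ((k.1 + 1 : ℕ) : ℂ)) ^ M‖ ^ 2)
    + lam * tvNorm w

/-- The data vector `(y₀, y₁, …, y_{Kc}) ∈ ℂ^{Kc+1}`. -/
noncomputable def yVec (Kc : ℕ) (y0 : ℝ) (yr : Fin Kc → ℂ) : Fin (Kc + 1) → ℂ :=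
  Fin.cases (y0 : ℂ) fun j => yr j

/-- The system matrix `H_{k,p} = e^{-2πikp/P} β̂[k]`. -/
noncomputable def Hmat (M P Kc : ℕ) (k : Fin (Kc + 1)) (p : Fin P) : ℂ :=
  Complex.exp (-(2 * Real.pi * Complex.I * (k.1 : ℂ) * (p.1 : ℂ)) / (P : ℂ)) *
    bsplineCoeff M P (k.1 : ℤ)

/-- The discrete objective
`G(c) = ½ Σ_k |y_k - (Hc)_k|² + λ (P^{M-1}/(2π)^M) Σ_p |(d ⊛ c)[p]|`. -/
noncomputable def Gdisc (M P Kc : ℕ) (y0 : ℝ) (yr : Fin Kc → ℂ) (lam : ℝ)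
    (c : Fin P → ℝ) : ℝ :=
  (1 / 2) * ∑ k : Fin (Kc + 1), ‖yVec Kc y0 yr k - ∑ p, Hmat M P Kc k p * (c p : ℂ)‖ ^ 2
    + lam * ((P : ℝ) ^ (M - 1) / (2 * Real.pi) ^ M) * ∑ p, |cconv P (dFilter M P) c p|

/-- The innovation measure `w_c = (P^{M-1}/(2π)^M) Σ_p (d ⊛ c)[p] δ_{2πp/P}` of a uniform spline. -/
noncomputable def wOfc (M P : ℕ) (c : Fin P → ℝ) : SignedMeasure Circle2pi :=
  ∑ p, ((P : ℝ) ^ (M - 1) / (2 * Real.pi) ^ M * cconv P (dFilter M P) c p) • diracSM (gridPt P p)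

/-- The mean `a_c = (1/P) Σ_p c_p` of the uniform spline with B-spline coefficients `c`. -/
noncomputable def aOfc (P : ℕ) (c : Fin P → ℝ) : ℝ := (1 / (P : ℝ)) * ∑ p, c p

end

section helpers

/-! ### Discrete part -/

/-- cyclic shift -/
def shiftL (n : ℕ) : Module.End ℝ (Fin (n + 1) → ℝ) where
  toFun c := fun p => c (p - 1)
  map_add' _ _ := rfl
  map_smul' _ _ := rfl

/-- cyclic backward difference -/
def diffL (n : ℕ) : Module.End ℝ (Fin (n + 1) → ℝ) := 1 - shiftL n

lemma diffL_apply (n : ℕ) (c : Fin (n + 1) → ℝ) (p : Fin (n + 1)) :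
    diffL n c p = c p - c (p - 1) := rfl

open Fin.CommRing in
lemma shiftL_pow (n m : ℕ) (c : Fin (n + 1) → ℝ) (p : Fin (n + 1)) :
    (shiftL n ^ m) c p = c (p - (m : Fin (n + 1))) := by
  induction m generalizing p with
  | zero => simp
  | succ m ih =>
    rw [pow_succ', Module.End.mul_apply]
    change (shiftL n ^ m) c (p - 1) = _
    rw [ih]
    congr 1
    push_cast
    ring

open Fin.CommRing in
lemma cconv_eq (M n : ℕ) (c : Fin (n + 1) → ℝ) :
    cconv (n + 1) (dFilter M (n + 1)) c = (diffL n ^ M) c := by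
  have h1 : diffL n ^ M = ∑ m ∈ Finset.range (M + 1),
      ((-1 : ℝ) ^ m * (M.choose m)) • shiftL n ^ m := by
    have : diffL n = (-1 : ℝ) • shiftL n + 1 := by 
      refine LinearMap.ext fun v => funext fun p => ?_
      simp [diffL]
      ring
    rw [this, (Commute.one_right _).add_pow]
    refine Finset.sum_congr rfl fun m _ => ?_
    rw [smul_pow, one_pow, mul_one, ← nsmul_eq_mul', mul_smul, Nat.cast_smul_eq_nsmul,
      smul_comm]
  ext p
  rw [h1]
  simp only [cconv, dFilter, Finset.sum_mul, LinearMap.sum_apply, Finset.sum_apply,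
    LinearMap.smul_apply, Pi.smul_apply, shiftL_pow, smul_eq_mul]
  rw [Finset.sum_comm]
  refine Finset.sum_congr rfl fun m _ => ?_
  rw [Finset.sum_eq_single (p - (m : Fin (n + 1)))]
  · rw [if_pos]
    simp [Fin.val_natCast]
  · intro q _ hq
    rw [if_neg, zero_mul]
    intro h
    apply hq
    have : (m : Fin (n + 1)) = p - q := by
      apply Fin.ext
      rw [Fin.val_natCast, h]
    rw [this]; abel
  · simp

lemma sum_diffL (n : ℕ) (c : Fin (n + 1) → ℝ) : ∑ p, diffL n c p = 0 := by
  simp only [diffL_apply, Finset.sum_sub_distrib]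
  have := Equiv.sum_comp (Equiv.subRight (1 : Fin (n + 1))) c
  simp only [Equiv.subRight_apply] at this
  rw [this, sub_self]

lemma diffL_eq_zero (n : ℕ) (c : Fin (n + 1) → ℝ) (h : diffL n c = 0) (hs : ∑ p, c p = 0) :
    c = 0 := by
  have h0 : ∀ p, c p = c (p - 1) := fun p => by
    have := congrFun h p
    rw [diffL_apply] at this
    simpa [sub_eq_zero] using this
  have hc : ∀ p, c p = c 0 := by
    intro p
    induction p using Fin.induction with
    | zero => rfl
    | succ i ih =>
      rw [h0, ← ih]
      congr 1
      rw [sub_eq_iff_eq_add]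
      simp
  have : ((n : ℝ) + 1) * c 0 = 0 := by
    rw [← hs, Finset.sum_congr rfl fun p _ => hc p]
    simp
  have h00 : c 0 = 0 := by
    rcases mul_eq_zero.mp this with h | h
    · have : (0 : ℝ) < (n : ℝ) + 1 := by positivity
      linarith
    · exact h
  ext p
  rw [hc, h00]; rfl

lemma sum_diffL_pow (n m : ℕ) (hm : 1 ≤ m) (c : Fin (n + 1) → ℝ) :
    ∑ p, (diffL n ^ m) c p = 0 := by
  obtain ⟨k, rfl⟩ := Nat.exists_eq_add_of_le' hm
  rw [pow_succ', Module.End.mul_apply, sum_diffL]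

lemma diffL_pow_eq_zero (n m : ℕ) (c : Fin (n + 1) → ℝ) (hs : ∑ p, c p = 0)
    (h : (diffL n ^ m) c = 0) : c = 0 := by
  induction m with
  | zero => simpa using h
  | succ m ih =>
    apply ih
    rw [pow_succ', Module.End.mul_apply] at h
    refine diffL_eq_zero n _ h ?_
    rcases Nat.eq_zero_or_pos m with rfl | hm
    · simpa using hs
    · exact sum_diffL_pow n m hm c

/-- sum-zero vectors -/
def sumZero (n : ℕ) : Submodule ℝ (Fin (n + 1) → ℝ) where
  carrier := {c | ∑ p, c p = 0}
  add_mem' {a b} ha hb := by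
    simp only [Set.mem_ofPred_eq] at *
    simp [Finset.sum_add_distrib, ha, hb]
  zero_mem' := by simp
  smul_mem' r a ha := by
    simp only [Set.mem_ofPred_eq] at *
    simp [← Finset.mul_sum, ha]

lemma exists_diffL_pow (n m : ℕ) (hm : 1 ≤ m) (b : Fin (n + 1) → ℝ) (hb : ∑ p, b p = 0) :
    ∃ c : Fin (n + 1) → ℝ, ∑ p, c p = 0 ∧ (diffL n ^ m) c = b := by
  let T : sumZero n →ₗ[ℝ] sumZero n :=
    (diffL n ^ m).restrict (fun c _ => sum_diffL_pow n m hm c)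
  have hinj : Function.Injective T := by
    rw [← LinearMap.ker_eq_bot, LinearMap.ker_eq_bot']
    intro c hc
    apply Subtype.ext
    exact diffL_pow_eq_zero n m c.1 c.2 (congrArg Subtype.val hc)
  obtain ⟨c, hc⟩ := LinearMap.injective_iff_surjective.mp hinj ⟨b, hb⟩
  exact ⟨c.1, c.2, congrArg Subtype.val hc⟩

lemma dft_diffL (n : ℕ) (z : ℂ) (hz : z ^ (n + 1) = 1) (c : Fin (n + 1) → ℝ) :
    ∑ p, ((diffL n c p : ℝ) : ℂ) * z ^ p.1 = (1 - z) * ∑ p, (c p : ℂ) * z ^ p.1 := by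
  simp only [diffL_apply, Complex.ofReal_sub, sub_mul, Finset.sum_sub_distrib, one_mul]
  congr 1
  rw [← Equiv.sum_comp (Equiv.addRight (1 : Fin (n + 1))), Finset.mul_sum]
  refine Finset.sum_congr rfl fun q _ => ?_
  have : z ^ (q + 1 : Fin (n + 1)).1 = z ^ (q.1 + 1) := by
    rw [pow_eq_pow_mod (q.1 + 1) hz]
    congr 1
    simp [Fin.val_add]
  simp only [Equiv.coe_addRight, add_sub_cancel_right]
  rw [this]; ring

lemma dft_diffL_pow (n m : ℕ) (z : ℂ) (hz : z ^ (n + 1) = 1) (c : Fin (n + 1) → ℝ) :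
    ∑ p, (((diffL n ^ m) c p : ℝ) : ℂ) * z ^ p.1 = (1 - z) ^ m * ∑ p, (c p : ℂ) * z ^ p.1 := by
  induction m with
  | zero => simp
  | succ m ih =>
    rw [pow_succ', Module.End.mul_apply, dft_diffL n z hz, ih]; ring

/-! ### Measure part -/

lemma gridPt_injective (n : ℕ) : Function.Injective (gridPt (n + 1)) := by
  have hmem : ∀ p : Fin (n + 1), 2 * Real.pi * (p.1 : ℝ) / ((n + 1 : ℕ) : ℝ) ∈
      Set.Ico (0 : ℝ) (0 + 2 * Real.pi) := by
    intro p
    refine ⟨by positivity, ?_⟩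
    rw [zero_add, div_lt_iff₀ (by positivity)]
    have : (p.1 : ℝ) < ((n + 1 : ℕ) : ℝ) := by exact_mod_cast p.2
    have := Real.pi_pos
    gcongr
  intro p q h
  unfold gridPt at h
  rw [AddCircle.coe_eq_coe_iff_of_mem_Ico (hmem p) (hmem q)] at h
  have h2 : (2 * Real.pi) ≠ 0 := by positivity
  have h3 : ((n + 1 : ℕ) : ℝ) ≠ 0 := by positivity
  rw [div_left_inj' h3, mul_right_inj' h2] at h
  exact Fin.ext (by exact_mod_cast h)

lemma sum_apply_sm {ι : Type*} [Fintype ι] (b : ι → ℝ) (x : ι → Circle2pi)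
    {s : Set Circle2pi} (hs : MeasurableSet s) :
    (∑ p, b p • diracSM (x p)) s = ∑ p, b p * s.indicator (fun _ => (1 : ℝ)) (x p) := by
  have : (∑ p, b p • diracSM (x p)) s = ∑ p, (b p • diracSM (x p)) s := by
    induction (Finset.univ : Finset ι) using Finset.cons_induction with
    | empty => simp
    | cons a t ha ih => rw [Finset.sum_cons, Finset.sum_cons, ← ih]; rfl
  rw [this]
  refine Finset.sum_congr rfl fun p _ => ?_
  change b p * diracSM (x p) s = _
  congr 1
  rw [diracSM, Measure.toSignedMeasure_apply_measurable hs, Measure.real,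
    Measure.dirac_apply' _ hs]
  by_cases h : x p ∈ s <;> simp [h]

/-- nonnegative combination of Diracs -/
noncomputable def posM {ι : Type*} [Fintype ι] (b : ι → ℝ) (x : ι → Circle2pi) : Measure Circle2pi :=
  ∑ p, (b p).toNNReal • Measure.dirac (x p)

instance posM_fin {ι : Type*} [Fintype ι] (b : ι → ℝ) (x : ι → Circle2pi) :
    IsFiniteMeasure (posM b x) := by
  unfold posM; infer_instance

lemma posM_apply {ι : Type*} [Fintype ι] (b : ι → ℝ) (x : ι → Circle2pi)
    {s : Set Circle2pi} (hs : MeasurableSet s) :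
    posM b x s = ∑ p, ((b p).toNNReal : ℝ≥0∞) * s.indicator 1 (x p) := by
  rw [posM, Measure.finsetSum_apply]
  refine Finset.sum_congr rfl fun p _ => ?_
  rw [Measure.smul_apply, Measure.dirac_apply' _ hs, ENNReal.smul_def, smul_eq_mul]

lemma posM_real {ι : Type*} [Fintype ι] (b : ι → ℝ) (x : ι → Circle2pi)
    {s : Set Circle2pi} (hs : MeasurableSet s) :
    (posM b x).real s = ∑ p, max (b p) 0 * s.indicator (fun _ => (1 : ℝ)) (x p) := by
  rw [Measure.real, posM_apply b x hs, ENNReal.toReal_sum]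
  · refine Finset.sum_congr rfl fun p _ => ?_
    by_cases h : x p ∈ s <;> simp [h]
  · intro p _
    by_cases h : x p ∈ s <;> simp [h]

lemma posM_sing {ι : Type*} [Fintype ι] (b : ι → ℝ) (x : ι → Circle2pi)
    (hx : Function.Injective x) : posM b x ⟂ₘ posM (fun p => -b p) x := by
  have hfin : (x '' {p | b p ≤ 0}).Finite := Set.toFinite _
  refine ⟨x '' {p | b p ≤ 0}, hfin.measurableSet, ?_, ?_⟩
  · rw [posM_apply _ _ hfin.measurableSet]
    refine Finset.sum_eq_zero fun p _ => ?_
    by_cases h : b p ≤ 0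
    · simp [Real.toNNReal_of_nonpos h]
    · rw [Set.indicator_of_notMem, mul_zero]
      rintro ⟨q, hq, hqp⟩
      rw [hx hqp] at hq
      exact h hq
  · rw [posM_apply _ _ hfin.measurableSet.compl]
    refine Finset.sum_eq_zero fun p _ => ?_
    by_cases h : b p ≤ 0
    · rw [Set.indicator_of_notMem, mul_zero]
      simp only [Set.mem_compl_iff, not_not]
      exact ⟨p, h, rfl⟩
    · simp [Real.toNNReal_of_nonpos (show -b p ≤ 0 by linarith)]

/-- explicit Jordan decomposition -/
noncomputable def jd {ι : Type*} [Fintype ι] (b : ι → ℝ) (x : ι → Circle2pi)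
    (hx : Function.Injective x) : JordanDecomposition Circle2pi where
  posPart := posM b x
  negPart := posM (fun p => -b p) x
  mutuallySingular := posM_sing b x hx

lemma jd_eq {ι : Type*} [Fintype ι] (b : ι → ℝ) (x : ι → Circle2pi)
    (hx : Function.Injective x) :
    (∑ p, b p • diracSM (x p)).toJordanDecomposition = jd b x hx := by
  apply SignedMeasure.toJordanDecomposition_eq
  ext s hs
  rw [sum_apply_sm b x hs, JordanDecomposition.toSignedMeasure,
    Measure.toSignedMeasure_sub_apply hs]
  change _ = (posM b x).real s - (posM (fun p => -b p) x).real s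
  rw [posM_real _ _ hs, posM_real _ _ hs, ← Finset.sum_sub_distrib]
  refine Finset.sum_congr rfl fun p _ => ?_
  rw [← sub_mul]
  congr 1
  rcases le_total (b p) 0 with h | h
  · rw [max_eq_right h, max_eq_left (by linarith)]; ring
  · rw [max_eq_left h, max_eq_right (by linarith)]; ring

lemma tvNorm_sum {ι : Type*} [Fintype ι] (b : ι → ℝ) (x : ι → Circle2pi)
    (hx : Function.Injective x) : tvNorm (∑ p, b p • diracSM (x p)) = ∑ p, |b p| := by
  rw [tvNorm, SignedMeasure.totalVariation, jd_eq b x hx]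
  change ((posM b x + posM (fun p => -b p) x).real Set.univ) = _
  rw [measureReal_add_apply, posM_real _ _ MeasurableSet.univ, posM_real _ _ MeasurableSet.univ,
    ← Finset.sum_add_distrib]
  refine Finset.sum_congr rfl fun p _ => ?_
  simp only [Set.indicator_univ, mul_one]
  rcases le_total (b p) 0 with h | h
  · rw [max_eq_right h, max_eq_left (by linarith), abs_of_nonpos h]; ring
  · rw [max_eq_left h, max_eq_right (by linarith), abs_of_nonneg h]; ring

lemma integral_posM {ι : Type*} [Fintype ι] (b : ι → ℝ) (x : ι → Circle2pi)
    (f : Circle2pi → ℂ) : ∫ t, f t ∂(posM b x) = ∑ p, ((max (b p) 0 : ℝ) : ℂ) * f (x p) := by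
  rw [posM, integral_finsetSum_measure]
  · refine Finset.sum_congr rfl fun p _ => ?_
    rw [integral_smul_nnreal_measure, integral_dirac]
    simp [NNReal.smul_def]
  · intro p _
    exact (integrable_dirac (by simp)).smul_measure_nnreal

lemma sIntC_sum {ι : Type*} [Fintype ι] (b : ι → ℝ) (x : ι → Circle2pi)
    (hx : Function.Injective x) (f : Circle2pi → ℂ) :
    sIntC (∑ p, b p • diracSM (x p)) f = ∑ p, (b p : ℂ) * f (x p) := by
  rw [sIntC, jd_eq b x hx]
  change (∫ t, f t ∂(posM b x)) - (∫ t, f t ∂(posM (fun p => -b p) x)) = _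
  rw [integral_posM, integral_posM, ← Finset.sum_sub_distrib]
  refine Finset.sum_congr rfl fun p _ => ?_
  rw [← sub_mul, ← Complex.ofReal_sub]
  congr 2
  rcases le_total (b p) 0 with h | h
  · rw [max_eq_right h, max_eq_left (by linarith)]; ring
  · rw [max_eq_left h, max_eq_right (by linarith)]; ring

lemma coeff_eq_s13 {ι : Type*} [Fintype ι] (b b' : ι → ℝ) (x : ι → Circle2pi)
    (hx : Function.Injective x)
    (h : ∑ p, b p • diracSM (x p) = ∑ p, b' p • diracSM (x p)) : b = b' := by
  classical
  ext q
  have key : ∀ b : ι → ℝ, (∑ p, b p • diracSM (x p)) {x q} = b q := by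
    intro b
    rw [sum_apply_sm b x (measurableSet_singleton _), Finset.sum_eq_single q]
    · simp
    · intro p _ hp
      rw [Set.indicator_of_notMem, mul_zero]
      intro h
      exact hp (hx h)
    · simp
  rw [← key b, ← key b', h]

/-! ### Assembly -/

lemma scale_pos (M n : ℕ) : 0 < ((n + 1 : ℕ) : ℝ) ^ (M - 1) / (2 * Real.pi) ^ M := by
  positivity

lemma fourier_gridPt (n k : ℕ) (p : Fin (n + 1)) :
    (fourier (-(k : ℤ)) (gridPt (n + 1) p) : ℂ) =
      Complex.exp (-(2 * Real.pi * Complex.I * (k : ℂ)) / ((n + 1 : ℕ) : ℂ)) ^ p.1 := by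
  rw [gridPt, fourier_coe_apply, ← Complex.exp_nat_mul]
  congr 1
  have h2 : (Real.pi : ℂ) ≠ 0 := by exact_mod_cast Real.pi_ne_zero
  have h3 : ((n + 1 : ℕ) : ℂ) ≠ 0 := by exact_mod_cast Nat.succ_ne_zero n
  push_cast at *
  field_simp

lemma fCoeff_wOfc (M n k : ℕ) (c : Fin (n + 1) → ℝ) :
    fCoeff (wOfc M (n + 1) c) (k : ℤ) =
      (((n + 1 : ℕ) : ℂ) ^ (M - 1) / (2 * Real.pi) ^ M) *
      ((1 - Complex.exp (-(2 * Real.pi * Complex.I * (k : ℂ)) / ((n + 1 : ℕ) : ℂ))) ^ M *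
        ∑ p, (c p : ℂ) *
          Complex.exp (-(2 * Real.pi * Complex.I * (k : ℂ)) / ((n + 1 : ℕ) : ℂ)) ^ p.1) := by
  have hz : Complex.exp (-(2 * Real.pi * Complex.I * (k : ℂ)) / ((n + 1 : ℕ) : ℂ)) ^ (n + 1)
      = 1 := by
    rw [← Complex.exp_nat_mul, Complex.exp_eq_one_iff]
    refine ⟨-(k : ℤ), ?_⟩
    have h3 : ((n + 1 : ℕ) : ℂ) ≠ 0 := by exact_mod_cast Nat.succ_ne_zero n
    rw [mul_div_cancel₀ _ h3]
    push_cast; ring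
  rw [fCoeff, wOfc, sIntC_sum _ _ (gridPt_injective n), ← dft_diffL_pow n M _ hz c,
    Finset.mul_sum, cconv_eq]
  refine Finset.sum_congr rfl fun p _ => ?_
  rw [fourier_gridPt]
  push_cast
  ring

lemma quadJ_eq (M n Kc : ℕ) (lam y0 : ℝ) (yr : Fin Kc → ℂ) (c : Fin (n + 1) → ℝ) :
    quadJ M Kc y0 yr lam (wOfc M (n + 1) c) (aOfc (n + 1) c) =
      Gdisc M (n + 1) Kc y0 yr lam c := by
  unfold quadJ Gdisc
  congr 1
  · congr 1
    rw [Fin.sum_univ_succ]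
    congr 1
    · have : yVec Kc y0 yr 0 - ∑ p, Hmat M (n + 1) Kc 0 p * (c p : ℂ)
          = ((y0 - aOfc (n + 1) c : ℝ) : ℂ) := by
        simp [yVec, Hmat, bsplineCoeff, aOfc, Finset.mul_sum]
      rw [this, Complex.norm_real, Real.norm_eq_abs, sq_abs]
    · refine Finset.sum_congr rfl fun k _ => ?_
      congr 3
      have hcast : ((k.1 : ℤ) + 1) = ((k.1 + 1 : ℕ) : ℤ) := by push_cast; rfl
      have hk : ((k.1 + 1 : ℕ) : ℂ) ≠ 0 := by exact_mod_cast Nat.succ_ne_zero k.1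
      have h2 : (Real.pi : ℂ) ≠ 0 := by exact_mod_cast Real.pi_ne_zero
      rw [hcast, fCoeff_wOfc, Finset.mul_sum, Finset.mul_sum, Finset.sum_div]
      refine Finset.sum_congr rfl fun p _ => ?_
      have hne : (((k.1 + 1 : ℕ)) : ℤ) ≠ 0 := by positivity
      simp only [Hmat, bsplineCoeff, Fin.val_succ, if_neg hne, Int.cast_natCast]
      have he : Complex.exp (-(2 * Real.pi * Complex.I * ((k.1 + 1 : ℕ) : ℂ) * (p.1 : ℂ)) /
          ((n + 1 : ℕ) : ℂ)) =
          Complex.exp (-(2 * Real.pi * Complex.I * ((k.1 + 1 : ℕ) : ℂ)) /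
            ((n + 1 : ℕ) : ℂ)) ^ p.1 := by
        rw [← Complex.exp_nat_mul]; congr 1; ring
      rw [he]
      generalize Complex.exp (-(2 * Real.pi * Complex.I * ((k.1 + 1 : ℕ) : ℂ)) /
            ((n + 1 : ℕ) : ℂ)) = z
      generalize ((k.1 + 1 : ℕ) : ℂ) = K at hk
      rw [div_pow, mul_pow, mul_pow, mul_pow, mul_pow, mul_pow]
      have hI := Complex.I_ne_zero
      field_simp
  · rw [wOfc, tvNorm_sum _ _ (gridPt_injective n), mul_assoc lam]
    congr 1
    rw [Finset.mul_sum]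
    refine Finset.sum_congr rfl fun p _ => ?_
    rw [abs_mul, abs_of_pos (scale_pos M n)]

lemma wOfc_inj (M n : ℕ) (c c' : Fin (n + 1) → ℝ)
    (hw : wOfc M (n + 1) c = wOfc M (n + 1) c') (ha : aOfc (n + 1) c = aOfc (n + 1) c') :
    c = c' := by
  have h := coeff_eq_s13 _ _ _ (gridPt_injective n) hw
  have h1 : (diffL n ^ M) (c - c') = 0 := by
    ext p
    have := mul_left_cancel₀ (scale_pos M n).ne' (congrFun h p)
    rw [cconv_eq, cconv_eq] at this
    rw [map_sub, Pi.sub_apply, this, sub_self]; rfl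
  have h2 : ∑ p, (c - c') p = 0 := by
    have h3 : (1 / ((n + 1 : ℕ) : ℝ)) ≠ 0 := by positivity
    have := mul_left_cancel₀ h3 ha
    simp [Finset.sum_sub_distrib, this]
  exact sub_eq_zero.mp (diffL_pow_eq_zero n M _ h2 h1)

lemma wOfc_grid (M n : ℕ) (hM : 1 ≤ M) (c : Fin (n + 1) → ℝ) :
    IsGridMeasure (n + 1) (wOfc M (n + 1) c) := by
  refine ⟨_, ?_, rfl⟩
  rw [← Finset.mul_sum, cconv_eq, sum_diffL_pow n M hM, mul_zero]

lemma wOfc_surj (M n : ℕ) (hM : 1 ≤ M) (w : SignedMeasure Circle2pi) (a : ℝ)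
    (hw : IsGridMeasure (n + 1) w) :
    ∃ c : Fin (n + 1) → ℝ, wOfc M (n + 1) c = w ∧ aOfc (n + 1) c = a := by
  obtain ⟨b, hb, rfl⟩ := hw
  have hs := (scale_pos M n).ne'
  obtain ⟨c, hc, hcb⟩ := exists_diffL_pow n M hM
    (fun p => (((n + 1 : ℕ) : ℝ) ^ (M - 1) / (2 * Real.pi) ^ M)⁻¹ * b p)
    (by rw [← Finset.mul_sum, hb, mul_zero])
  have hconst : (diffL n ^ M) (fun _ => a) = 0 := by
    obtain ⟨k, rfl⟩ := Nat.exists_eq_add_of_le' hM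
    have : diffL n (fun _ => a) = 0 := by ext p; simp [diffL_apply]
    rw [pow_succ, Module.End.mul_apply, this, map_zero]
  refine ⟨c + fun _ => a, ?_, ?_⟩
  · unfold wOfc
    refine Finset.sum_congr rfl fun p _ => ?_
    rw [cconv_eq, map_add, hconst, add_zero, hcb, mul_inv_cancel_left₀ hs]
  · have h3 : ((n : ℝ) + 1) ≠ 0 := by positivity
    simp [aOfc, Finset.sum_add_distrib, hc]
    field_simp

end helpers

/-- Exact discretization: `c ↦ (w_c, a_c)` is a bijection from `ℝ^P`
onto the grid-restricted class, the continuous objective `J(w_c, a_c)` equals the discrete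
objective `G(c)`, and hence `c*` minimizes `G` iff `(w_{c*}, a_{c*})` minimizes `J` over
the grid-restricted class. -/
theorem stmt13 (M P Kc : ℕ) (hM : 2 ≤ M) (hP : 1 ≤ P) (lam : ℝ) (hlam : 0 < lam)
    (y0 : ℝ) (yr : Fin Kc → ℂ) :
    (∀ c c' : Fin P → ℝ, wOfc M P c = wOfc M P c' → aOfc P c = aOfc P c' → c = c') ∧
    (∀ c : Fin P → ℝ, IsGridMeasure P (wOfc M P c)) ∧
    (∀ (w : SignedMeasure Circle2pi) (a : ℝ), IsGridMeasure P w →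
      ∃ c : Fin P → ℝ, wOfc M P c = w ∧ aOfc P c = a) ∧
    (∀ c : Fin P → ℝ,
      quadJ M Kc y0 yr lam (wOfc M P c) (aOfc P c) = Gdisc M P Kc y0 yr lam c) ∧
    (∀ cstar : Fin P → ℝ,
      (∀ c : Fin P → ℝ, Gdisc M P Kc y0 yr lam cstar ≤ Gdisc M P Kc y0 yr lam c) ↔
        (∀ (w : SignedMeasure Circle2pi) (a : ℝ), IsGridMeasure P w →
          quadJ M Kc y0 yr lam (wOfc M P cstar) (aOfc P cstar) ≤
            quadJ M Kc y0 yr lam w a)) := by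
  obtain ⟨n, rfl⟩ := Nat.exists_eq_add_of_le' hP
  have hM1 : 1 ≤ M := by omega
  refine ⟨wOfc_inj M n, wOfc_grid M n hM1, wOfc_surj M n hM1, quadJ_eq M n Kc lam y0 yr, ?_⟩
  intro cstar
  constructor
  · intro h w a hw
    obtain ⟨c, rfl, rfl⟩ := wOfc_surj M n hM1 w a hw
    rw [quadJ_eq, quadJ_eq]
    exact h c
  · intro h c
    rw [← quadJ_eq, ← quadJ_eq]
    exact h _ _ (wOfc_grid M n hM1 c)
end
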